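/- Let k be a field, X and Y indeterminates, V = k(X)[[Y]], M = Y·k(X)[[Y]], and R = k + M. Then the finitely generated ideal I = (Y, XY)R and the principal ideal J = YR of R satisfy: I_t = M, (J·I)_t = M² = (I²)_t, and J_t = YR ≠ M = I_t. Consequently J is a nontrivial t-reduction of the finitely generated ideal I, so the (integrally closed) domain R does not have the finite t-basic ideal property. -/

import Mathlib

set_option synthInstance.maxHeartbeats 1000000
set_option maxHeartbeats 2000000

noncomputable section

variable (k : Type*) [Field k]

/-- `V = k(X)[[Y]]`, the power series ring over the rational function field `k(X)`. -/
abbrev Vk := PowerSeries (RatFunc k)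

/-- The subring `R = k + M` of `V = k(X)[[Y]]` (where `M = Y·V`): power series whose
constant term lies in `k`. -/
def subR : Subring (Vk k) :=
  Subring.comap (PowerSeries.constantCoeff (R := RatFunc k)) (algebraMap k (RatFunc k)).range

/-- The quotient field `K` of `R` (which is also the quotient field of `V`). -/
abbrev FieldK := FractionRing (Vk k)

/-- `Y` as an element of `R`. -/
def yR : subR k :=
  ⟨PowerSeries.X, by simp [subR, Subring.mem_comap]⟩

/-- `X·Y` as an element of `R`. -/
def xyR : subR k :=
  ⟨PowerSeries.C (R := RatFunc k) RatFunc.X * PowerSeries.X, by simp [subR, Subring.mem_comap]⟩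

/-- The maximal ideal `M = Y·k(X)[[Y]]` of `V`, viewed as an ideal of `R = k + M`
(the kernel of the constant-term map on `R`). -/
def idealMR : Ideal (subR k) :=
  RingHom.ker ((PowerSeries.constantCoeff (R := RatFunc k)).comp (subR k).subtype)

/-- An ideal of `R` regarded as an `R`-submodule of the quotient field `K`. -/
def idl (I : Ideal (subR k)) : Submodule (subR k) (FieldK k) :=
  Submodule.map (Algebra.linearMap (subR k) (FieldK k)) I

/-- The `t`-operation on fractional `R`-ideals (as `R`-submodules of `K`):
`A_t = ⋃ B_v` over the nonzero finitely generated `R`-submodules `B ≤ A`, where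
`B_v = 1/(1/B)`. -/
def tSub (A : Submodule (subR k) (FieldK k)) : Submodule (subR k) (FieldK k) :=
  ⨆ (B : Submodule (subR k) (FieldK k)) (_ : B ≠ ⊥) (_ : B ≤ A) (_ : B.FG),
    (1 : Submodule (subR k) (FieldK k)) / ((1 : Submodule (subR k) (FieldK k)) / B)

abbrev phi : Vk k →+* FieldK k := algebraMap (Vk k) (FieldK k)

theorem phi_inj : Function.Injective (phi k) := IsFractionRing.injective (Vk k) (FieldK k)

theorem algMap_R (r : subR k) : algebraMap (subR k) (FieldK k) r = phi k (r : Vk k) := rfl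

theorem smul_R (r : subR k) (u : FieldK k) : r • u = phi k (r : Vk k) * u := by
  rw [Algebra.smul_def, algMap_R]

theorem phiY_ne : phi k PowerSeries.X ≠ 0 := by
  intro h
  exact PowerSeries.X_ne_zero (phi_inj k (h.trans (map_zero _).symm))

theorem mem_subR (f : Vk k) :
    f ∈ subR k ↔ ∃ a : k, RatFunc.C a = PowerSeries.constantCoeff f := by
  simp only [subR, Subring.mem_comap, RingHom.mem_range]
  rfl

theorem mem_subR_of_zero (f : Vk k) (h : PowerSeries.constantCoeff f = 0) : f ∈ subR k :=
  (mem_subR k f).2 ⟨0, by rw [h, map_zero]⟩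

theorem C_X_aux (a b : k) (h : (RatFunc.C b : RatFunc k) = RatFunc.X * RatFunc.C a) : a = 0 := by
  rw [← RatFunc.algebraMap_C, ← RatFunc.algebraMap_C, ← RatFunc.algebraMap_X, ← map_mul] at h
  have h2 := RatFunc.algebraMap_injective k h
  have h3 := congrArg (fun p => Polynomial.coeff p 1) h2
  simpa [Polynomial.coeff_C] using h3.symm

theorem const_zero (f : Vk k) (h : f ∈ subR k)
    (h' : PowerSeries.C (RatFunc.X : RatFunc k) * f ∈ subR k) :
    PowerSeries.constantCoeff f = 0 := by
  obtain ⟨a, ha⟩ := (mem_subR k f).1 h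
  obtain ⟨b, hb⟩ := (mem_subR k _).1 h'
  rw [map_mul, PowerSeries.constantCoeff_C, ← ha] at hb
  rw [← ha, C_X_aux k a b hb, map_zero]

theorem mem_one_iff (u : FieldK k) :
    u ∈ (1 : Submodule (subR k) (FieldK k)) ↔ ∃ f : Vk k, f ∈ subR k ∧ phi k f = u := by
  rw [Submodule.mem_one]
  constructor
  · rintro ⟨r, hr⟩
    exact ⟨r, r.2, hr⟩
  · rintro ⟨f, hf, h⟩
    exact ⟨⟨f, hf⟩, h⟩

/-- `Y^n V` as a submodule of `K`. -/
def PV (n : ℕ) : Submodule (subR k) (FieldK k) where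
  carrier := {u | ∃ f : Vk k, u = phi k (PowerSeries.X ^ n * f)}
  zero_mem' := ⟨0, by simp⟩
  add_mem' := by
    rintro _ _ ⟨f, rfl⟩ ⟨g, rfl⟩
    exact ⟨f + g, by rw [mul_add, map_add]⟩
  smul_mem' := by
    rintro r _ ⟨f, rfl⟩
    refine ⟨r * f, ?_⟩
    rw [smul_R, ← map_mul]
    congr 1
    ring

theorem mem_PV (n : ℕ) (u : FieldK k) :
    u ∈ PV k n ↔ ∃ f : Vk k, u = phi k (PowerSeries.X ^ n * f) := Iff.rfl

theorem tSub_FG (A : Submodule (subR k) (FieldK k)) (h0 : A ≠ ⊥) (hA : A.FG) :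
    tSub k A = 1 / (1 / A) := by
  apply le_antisymm
  · refine iSup_le fun B => iSup_le fun _ => iSup_le fun hBA => iSup_le fun _ => ?_
    intro w hw
    rw [Submodule.mem_div_iff_forall_mul_mem] at hw ⊢
    intro u hu
    apply hw
    rw [Submodule.mem_div_iff_forall_mul_mem] at hu ⊢
    intro b hb
    exact hu b (hBA hb)
  · exact le_iSup_of_le A (le_iSup_of_le h0 (le_iSup_of_le le_rfl (le_iSup_of_le hA le_rfl)))

theorem tSub_eq_PV (n : ℕ) (A : Submodule (subR k) (FieldK k)) (hA : A.FG)
    (h1 : phi k (PowerSeries.X ^ n) ∈ A)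
    (h2 : phi k (PowerSeries.C (RatFunc.X : RatFunc k) * PowerSeries.X ^ n) ∈ A)
    (hle : A ≤ PV k n) : tSub k A = PV k n := by
  have hY := phiY_ne k
  have hYn : phi k (PowerSeries.X ^ n) ≠ 0 := by rw [map_pow]; exact pow_ne_zero _ hY
  have h0 : A ≠ ⊥ := by
    rintro rfl
    exact hYn ((Submodule.mem_bot _).1 h1)
  have key : ∀ g : Vk k, phi k (PowerSeries.X * g) / phi k (PowerSeries.X ^ n) ∈
      (1 : Submodule (subR k) (FieldK k)) / A := by
    intro g
    rw [Submodule.mem_div_iff_forall_mul_mem]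
    intro a ha
    obtain ⟨f, rfl⟩ := hle ha
    rw [mem_one_iff]
    refine ⟨PowerSeries.X * g * f, mem_subR_of_zero k _ (by simp), ?_⟩
    rw [map_mul _ (PowerSeries.X * g) f, map_mul _ (PowerSeries.X ^ n) f]
    field_simp
  rw [tSub_FG k A h0 hA]
  apply le_antisymm
  · intro w hw
    rw [Submodule.mem_div_iff_forall_mul_mem] at hw
    obtain ⟨f, hf, hfw⟩ := (mem_one_iff k _).1 (hw _ (key 1))
    obtain ⟨g, hg, hgw⟩ := (mem_one_iff k _).1 (hw _ (key (PowerSeries.C RatFunc.X)))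
    have hgf : g = PowerSeries.C (RatFunc.X : RatFunc k) * f := by
      apply phi_inj k
      rw [map_mul, hfw, hgw, map_mul, map_mul, map_one]
      ring
    rw [hgf] at hg
    obtain ⟨q, hq⟩ := PowerSeries.X_dvd_iff.2 (const_zero k f hf hg)
    refine ⟨q, ?_⟩
    rw [hq, mul_one, map_mul] at hfw
    rw [map_mul]
    field_simp at hfw
    rw [← hfw, mul_comm]
  · rintro w ⟨g, rfl⟩
    rw [Submodule.mem_div_iff_forall_mul_mem]
    intro u hu
    rw [Submodule.mem_div_iff_forall_mul_mem] at hu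
    obtain ⟨f, hf, hfw⟩ := (mem_one_iff k _).1 (hu _ h1)
    obtain ⟨f', hf', hfw'⟩ := (mem_one_iff k _).1 (hu _ h2)
    have hff : f' = PowerSeries.C (RatFunc.X : RatFunc k) * f := by
      apply phi_inj k
      rw [map_mul, hfw, hfw', map_mul]
      ring
    rw [hff] at hf'
    have hc := const_zero k f hf hf'
    rw [mem_one_iff]
    refine ⟨f * g, mem_subR_of_zero k _ (by rw [map_mul, hc, zero_mul]), ?_⟩
    rw [map_mul, hfw, map_mul]
    ring

theorem mem_idl (I : Ideal (subR k)) (u : FieldK k) :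
    u ∈ idl k I ↔ ∃ r : subR k, r ∈ I ∧ phi k (r : Vk k) = u := Iff.rfl

theorem mem_M (r : subR k) :
    r ∈ idealMR k ↔ PowerSeries.constantCoeff (r : Vk k) = 0 := Iff.rfl

theorem idl_mono {I J : Ideal (subR k)} (h : I ≤ J) : idl k I ≤ idl k J := Submodule.map_mono h

theorem idl_FG {I : Ideal (subR k)} (h : I.FG) : (idl k I).FG := Submodule.FG.map _ h

theorem idl_M : idl k (idealMR k) = PV k 1 := by
  ext u
  rw [mem_idl, mem_PV]
  constructor
  · rintro ⟨r, hr, rfl⟩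
    obtain ⟨q, hq⟩ := PowerSeries.X_dvd_iff.2 ((mem_M k r).1 hr)
    exact ⟨q, by rw [hq, pow_one]⟩
  · rintro ⟨f, rfl⟩
    refine ⟨⟨PowerSeries.X ^ 1 * f, mem_subR_of_zero k _ (by simp)⟩, ?_, rfl⟩
    rw [mem_M]; simp

theorem idl_M2 : idl k (idealMR k ^ 2) = PV k 2 := by
  apply le_antisymm
  · rintro u ⟨r, hr, rfl⟩
    have hr' : r ∈ idealMR k ^ 2 := hr
    rw [pow_two] at hr'
    induction hr' using Submodule.mul_induction_on' with
    | mem_mul_mem a ha b hb =>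
      obtain ⟨p, hp⟩ := PowerSeries.X_dvd_iff.2 ((mem_M k a).1 ha)
      obtain ⟨q, hq⟩ := PowerSeries.X_dvd_iff.2 ((mem_M k b).1 hb)
      refine ⟨p * q, ?_⟩
      change phi k ((a : Vk k) * (b : Vk k)) = _
      rw [hp, hq]
      congr 1
      ring
    | add a ha b hb iha ihb =>
      rw [map_add]
      exact add_mem (iha (by rw [pow_two]; exact ha)) (ihb (by rw [pow_two]; exact hb))
  · rintro u ⟨f, rfl⟩
    refine ⟨yR k * ⟨PowerSeries.X * f, mem_subR_of_zero k _ (by simp)⟩, ?_, ?_⟩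
    · change _ ∈ idealMR k ^ 2
      rw [pow_two]
      refine Ideal.mul_mem_mul ?_ ?_
      · rw [mem_M]; simp [yR]
      · rw [mem_M]; simp
    · change phi k (PowerSeries.X * (PowerSeries.X * f)) = _
      congr 1
      ring

theorem I_le_M : Ideal.span {yR k, xyR k} ≤ idealMR k := by
  rw [Ideal.span_le]
  rintro r (rfl | rfl)
  · change _ = _
    simp [yR]
  · change _ = _
    simp [xyR]

theorem y_mem : yR k ∈ Ideal.span {yR k, xyR k} := Ideal.subset_span (by simp)

theorem xy_mem : xyR k ∈ Ideal.span {yR k, xyR k} := Ideal.subset_span (by simp)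

theorem J_le_I : Ideal.span {yR k} ≤ Ideal.span {yR k, xyR k} := Ideal.span_mono (by simp)

theorem I_FG : (Ideal.span {yR k, xyR k}).FG := Submodule.fg_span (by simp)

theorem J_FG : (Ideal.span {yR k}).FG := Submodule.fg_span (by simp)

theorem yR_ne : yR k ≠ 0 := fun h => PowerSeries.X_ne_zero (congrArg Subtype.val h)

theorem t_I : tSub k (idl k (Ideal.span {yR k, xyR k})) = PV k 1 := by
  refine tSub_eq_PV k 1 _ (idl_FG k (I_FG k)) ⟨_, y_mem k, ?_⟩ ⟨_, xy_mem k, ?_⟩ ?_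
  · change phi k PowerSeries.X = _
    rw [pow_one]
  · change phi k (PowerSeries.C (RatFunc.X : RatFunc k) * PowerSeries.X) = _
    rw [pow_one]
  · rw [← idl_M]
    exact idl_mono k (I_le_M k)

theorem t_2 (A : Ideal (subR k)) (hA : A.FG)
    (hl : Ideal.span {yR k} * Ideal.span {yR k, xyR k} ≤ A) (hu : A ≤ idealMR k ^ 2) :
    tSub k (idl k A) = PV k 2 := by
  have hy : yR k ∈ Ideal.span {yR k} := Ideal.subset_span (by simp)
  refine tSub_eq_PV k 2 _ (idl_FG k hA) ⟨_, hl (Ideal.mul_mem_mul hy (y_mem k)), ?_⟩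
    ⟨_, hl (Ideal.mul_mem_mul hy (xy_mem k)), ?_⟩ ?_
  · change phi k (PowerSeries.X * PowerSeries.X) = _
    congr 1
    ring
  · change phi k (PowerSeries.X * (PowerSeries.C (RatFunc.X : RatFunc k) * PowerSeries.X)) = _
    congr 1
    ring
  · rw [← idl_M2]
    exact idl_mono k hu

theorem t_JI : tSub k (idl k (Ideal.span {yR k} * Ideal.span {yR k, xyR k})) = PV k 2 := by
  refine t_2 k _ (Submodule.FG.mul (J_FG k) (I_FG k)) le_rfl ?_
  rw [pow_two]
  exact Ideal.mul_mono ((J_le_I k).trans (I_le_M k)) (I_le_M k)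

theorem t_I2 : tSub k (idl k (Ideal.span {yR k, xyR k} ^ 2)) = PV k 2 := by
  refine t_2 k _ (Submodule.FG.pow (I_FG k) 2) ?_ (Ideal.pow_right_mono (I_le_M k) 2)
  rw [pow_two]
  exact Ideal.mul_mono (J_le_I k) le_rfl

theorem t_J : tSub k (idl k (Ideal.span {yR k})) = idl k (Ideal.span {yR k}) := by
  have hY := phiY_ne k
  have hy : phi k PowerSeries.X ∈ idl k (Ideal.span {yR k}) :=
    ⟨yR k, Ideal.subset_span (by simp), rfl⟩
  rw [tSub_FG k _ _ (idl_FG k (J_FG k))]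
  · apply le_antisymm
    · intro w hw
      rw [Submodule.mem_div_iff_forall_mul_mem] at hw
      have hu : (phi k PowerSeries.X)⁻¹ ∈
          (1 : Submodule (subR k) (FieldK k)) / idl k (Ideal.span {yR k}) := by
        rw [Submodule.mem_div_iff_forall_mul_mem]
        rintro _ ⟨r, hr, rfl⟩
        obtain ⟨s, rfl⟩ := Ideal.mem_span_singleton.1 hr
        rw [mem_one_iff]
        refine ⟨s, s.2, ?_⟩
        change _ = _ * phi k (PowerSeries.X * (s : Vk k))
        rw [map_mul]
        field_simp
      obtain ⟨f, hf, hfw⟩ := (mem_one_iff k _).1 (hw _ hu)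
      refine ⟨yR k * ⟨f, hf⟩, Ideal.mem_span_singleton.2 (dvd_mul_right _ _), ?_⟩
      change phi k (PowerSeries.X * f) = _
      rw [map_mul, hfw]
      field_simp
    · intro w hw
      rw [Submodule.mem_div_iff_forall_mul_mem]
      intro u hu
      rw [mul_comm]
      exact (Submodule.mem_div_iff_forall_mul_mem.1 hu) w hw
  · intro h
    rw [h] at hy
    exact hY ((Submodule.mem_bot _).1 hy)

theorem J_ne_M : idl k (Ideal.span {yR k}) ≠ idl k (idealMR k) := by
  intro h
  have h1 : phi k (xyR k : Vk k) ∈ idl k (idealMR k) := ⟨_, I_le_M k (xy_mem k), rfl⟩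
  rw [← h] at h1
  obtain ⟨r, hr, hrr⟩ := h1
  obtain ⟨s, rfl⟩ := Ideal.mem_span_singleton.1 hr
  have h2 : PowerSeries.X * (s : Vk k) =
      PowerSeries.C (RatFunc.X : RatFunc k) * PowerSeries.X := phi_inj k hrr
  rw [mul_comm] at h2
  have h3 := mul_right_cancel₀ PowerSeries.X_ne_zero h2
  have h4 := const_zero k 1 (one_mem _) (by rw [mul_one, ← h3]; exact s.2)
  simp at h4

/-- Let `V = k(X)[[Y]]`, `M = Y·V` and `R = k + M`.  For `I = (Y, XY)R` and `J = YR` one has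
`I_t = M`, `(J·I)_t = M² = (I²)_t` and `J_t = YR ≠ M = I_t`; hence `J` is a nontrivial
`t`-reduction of the finitely generated ideal `I`, so `R` does not have the finite `t`-basic
ideal property. -/
theorem kplusM_not_finite_t_basic :
    tSub k (idl k (Ideal.span {yR k, xyR k})) = idl k (idealMR k)
      ∧ tSub k (idl k (Ideal.span {yR k} * Ideal.span {yR k, xyR k}))
          = idl k (idealMR k ^ 2)
      ∧ idl k (idealMR k ^ 2) = tSub k (idl k (Ideal.span {yR k, xyR k} ^ 2))
      ∧ tSub k (idl k (Ideal.span {yR k})) = idl k (Ideal.span {yR k})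
      ∧ idl k (Ideal.span {yR k}) ≠ idl k (idealMR k)
      ∧ ¬ (∀ I : Ideal (subR k), I ≠ ⊥ → I.FG →
            ∀ J : Ideal (subR k), J ≠ ⊥ → J ≤ I →
              (∃ n : ℕ, tSub k (idl k (J * I ^ n)) = tSub k (idl k (I ^ (n + 1)))) →
              tSub k (idl k J) = tSub k (idl k I)) := by
  refine ⟨(t_I k).trans (idl_M k).symm, (t_JI k).trans (idl_M2 k).symm,
    (idl_M2 k).trans (t_I2 k).symm, t_J k, J_ne_M k, ?_⟩
  intro H
  have hJ : Ideal.span {yR k} ≠ ⊥ := by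
    rw [Ne, Ideal.span_singleton_eq_bot]
    exact yR_ne k
  have hI : Ideal.span {yR k, xyR k} ≠ ⊥ := fun h => hJ (le_bot_iff.1 (h ▸ J_le_I k))
  have := H _ hI (I_FG k) _ hJ (J_le_I k) ⟨1, by rw [pow_one, t_JI k, t_I2 k]⟩
  rw [t_J, t_I, ← idl_M] at this
  exact J_ne_M k this

end
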